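/- Let (D_1,D_2,D_3) be uniform spacings on the 2-simplex and let f(D) = 1 + (D_1+D_2)(D_2+2D_3) + (19/10)Σ D_j ln D_j (comparisons toll) and g(D) = D_1 + (D_1+D_2)D_3 + (3/5)Σ D_j ln D_j (swaps toll), both centered appropriately. Then the asymptotic covariance constant σ_{C,S} of comparisons and swaps in Yaroslavskiy's Quicksort satisfies σ_{C,S} = 28/15 − (19/100)·π^2, where σ_{C,S} = E[Λ_1 Λ_2] for the unique centered square-integrable bivariate fixed point (Λ_1,Λ_2) of (Λ_1,Λ_2) =_d Σ_{r=1}^3 D_r (Λ_1^{(r)}, Λ_2^{(r)}) + (f(D), g(D)); in particular 2·E[f(D)·g(D)] = 28/15 − (19/100)·π^2. -/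

import Mathlib

open MeasureTheory ENNReal

/-- The distribution of the uniform spacings `(D₁, D₂)` on the 2-simplex
(with density 2 w.r.t. Lebesgue measure); `D₃ = 1 − D₁ − D₂`. -/
noncomputable def simplexMeasure : Measure (ℝ × ℝ) :=
  (2 : ℝ≥0∞) • volume.restrict {p : ℝ × ℝ | 0 ≤ p.1 ∧ 0 ≤ p.2 ∧ p.1 + p.2 ≤ 1}

/-- Comparisons toll: `f(D) = 1 + (D₁+D₂)(D₂+2D₃) + (19/10)·Σⱼ Dⱼ ln Dⱼ`. -/
noncomputable def cmpToll (p : ℝ × ℝ) : ℝ :=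
  1 + (p.1 + p.2) * (p.2 + 2 * (1 - p.1 - p.2)) +
    (19 / 10) * (p.1 * Real.log p.1 + p.2 * Real.log p.2
      + (1 - p.1 - p.2) * Real.log (1 - p.1 - p.2))

/-- Swaps toll: `g(D) = D₁ + (D₁+D₂)D₃ + (3/5)·Σⱼ Dⱼ ln Dⱼ`. -/
noncomputable def swapToll (p : ℝ × ℝ) : ℝ :=
  p.1 + (p.1 + p.2) * (1 - p.1 - p.2) +
    (3 / 5) * (p.1 * Real.log p.1 + p.2 * Real.log p.2
      + (1 - p.1 - p.2) * Real.log (1 - p.1 - p.2))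

open Set Filter Topology

/-! ### One-dimensional logarithmic integrals -/

lemma integral_pow_mul_xlogx {t : ℝ} (ht : 0 ≤ t) (n : ℕ) :
    ∫ x in (0 : ℝ)..t, x ^ n * (x * Real.log x)
      = t ^ (n + 1) * (t * Real.log t) / (n + 2) - t ^ (n + 2) / (n + 2) ^ 2 := by
  have hn : ((n : ℝ) + 2) ≠ 0 := by positivity
  have hc := Real.continuous_mul_log
  rw [intervalIntegral.integral_eq_sub_of_hasDerivAt_of_le
    (f := fun x => x ^ (n + 1) * (x * Real.log x) / (n + 2) - x ^ (n + 2) / (n + 2) ^ 2) ht]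
  · simp
  · exact Continuous.continuousOn (by fun_prop)
  · intro x hx
    have hx0 : x ≠ 0 := hx.1.ne'
    have h := (((hasDerivAt_pow (n + 1) x).mul (Real.hasDerivAt_mul_log hx0)).div_const
      ((n : ℝ) + 2)).sub ((hasDerivAt_pow (n + 2) x).div_const (((n : ℝ) + 2) ^ 2))
    convert! h using 1
    push_cast
    field_simp
    ring
  · exact Continuous.intervalIntegrable (by fun_prop) _ _

lemma integral_pow_mul_xlogx_sq (n : ℕ) :
    ∫ x in (0 : ℝ)..1, x ^ n * (x * Real.log x) ^ 2 = 2 / (n + 3) ^ 3 := by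
  have hn : ((n : ℝ) + 3) ≠ 0 := by positivity
  have hc := Real.continuous_mul_log
  rw [intervalIntegral.integral_eq_sub_of_hasDerivAt_of_le
    (f := fun x => x ^ (n + 1) * (x * Real.log x) ^ 2 / (n + 3)
      - 2 * (x ^ (n + 2) * (x * Real.log x)) / (n + 3) ^ 2 + 2 * x ^ (n + 3) / (n + 3) ^ 3)
    zero_le_one]
  · simp
  · exact Continuous.continuousOn (by fun_prop)
  · intro x hx
    have hx0 : x ≠ 0 := hx.1.ne'
    have hl := Real.hasDerivAt_mul_log hx0
    have h := ((((hasDerivAt_pow (n + 1) x).mul (hl.pow 2)).div_const ((n : ℝ) + 3)).sub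
      ((((hasDerivAt_pow (n + 2) x).mul hl).const_mul 2).div_const (((n : ℝ) + 3) ^ 2))).add
      (((hasDerivAt_pow (n + 3) x).const_mul 2).div_const (((n : ℝ) + 3) ^ 3))
    convert! h using 1
    simp only [Pi.pow_apply]
    push_cast
    field_simp
    ring
  · exact Continuous.intervalIntegrable (by fun_prop) _ _

lemma hasSum_sub_succ_of_antitone {w : ℕ → ℝ} (hw : Antitone w)
    (hlim : Tendsto w atTop (𝓝 0)) : HasSum (fun n => w n - w (n + 1)) (w 0) := by
  rw [hasSum_iff_tendsto_nat_of_nonneg (fun n => sub_nonneg.2 (hw n.le_succ))]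
  simp only [Finset.sum_range_sub']
  simpa using hlim.const_sub (w 0)

lemma hasSum_one_div_add_sq (k : ℕ) :
    HasSum (fun n : ℕ => 1 / ((n : ℝ) + k) ^ 2)
      (Real.pi ^ 2 / 6 - ∑ i ∈ Finset.range k, 1 / (i : ℝ) ^ 2) := by
  have h := (hasSum_nat_add_iff' (f := fun n : ℕ => 1 / (n : ℝ) ^ 2) k).2 hasSum_zeta_two
  simpa using h

lemma hasSum_harmonic_differences :
    HasSum (fun n : ℕ => 1 / ((n : ℝ) + 1) * (1 / (n + 3) ^ 2 - 1 / (n + 4) ^ 2))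
      (37 / 108 - Real.pi ^ 2 / 36) := by
  have anti (k : ℝ) (hk : 0 < k) : Antitone fun n : ℕ => 1 / ((n : ℝ) + k) := by
    intro m n hmn
    have : (m : ℝ) ≤ n := by exact_mod_cast hmn
    dsimp only
    gcongr
  have lim (k : ℝ) : Tendsto (fun n : ℕ => 1 / ((n : ℝ) + k)) atTop (𝓝 0) := by
    simp only [one_div]
    exact (tendsto_atTop_add_const_right _ k tendsto_natCast_atTop_atTop).inv_tendsto_atTop
  have h1 := hasSum_sub_succ_of_antitone (anti 1 (by norm_num)) (lim 1)
  have h2 := hasSum_sub_succ_of_antitone (anti 2 (by norm_num)) (lim 2)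
  have h3 := hasSum_sub_succ_of_antitone (anti 3 (by norm_num)) (lim 3)
  have s3 := hasSum_one_div_add_sq 3
  have s4 := hasSum_one_div_add_sq 4
  have h := ((((h1.add h2).mul_left (1 / 4)).sub (s3.mul_left (1 / 2))).sub
    (((h1.add h2).add h3).mul_left (1 / 9))).add (s4.mul_left (1 / 3))
  convert! h using 1
  · funext n
    push_cast
    have : (n : ℝ) + 1 ≠ 0 := by positivity
    have : (n : ℝ) + 2 ≠ 0 := by positivity
    have : (n : ℝ) + 3 ≠ 0 := by positivity
    have : (n : ℝ) + 4 ≠ 0 := by positivity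
    rw [show (n : ℝ) + 1 + 1 = n + 2 by ring, show (n : ℝ) + 1 + 2 = n + 3 by ring,
      show (n : ℝ) + 1 + 3 = n + 4 by ring]
    field_simp
    ring
  · norm_num [Finset.sum_range_succ]
    ring

lemma integral_xlogx_mul_one_sub_xlogx :
    ∫ x in (0 : ℝ)..1, (x * Real.log x) * ((1 - x) * Real.log (1 - x))
      = 37 / 108 - Real.pi ^ 2 / 36 := by
  have hc := Real.continuous_mul_log
  set F : ℕ → ℝ → ℝ := fun n x =>
    x ^ (n + 1) / (n + 1) * ((1 - x) * -(x * Real.log x)) with hF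
  have hFc (n : ℕ) : Continuous (F n) := by
    simp only [hF]
    fun_prop
  have hFint (n : ℕ) : ∫ x in Ioo (0 : ℝ) 1, F n x
      = 1 / ((n : ℝ) + 1) * (1 / (n + 3) ^ 2 - 1 / (n + 4) ^ 2) := by
    rw [← integral_Ioc_eq_integral_Ioo, ← intervalIntegral.integral_of_le zero_le_one]
    have h (x : ℝ) : F n x = 1 / ((n : ℝ) + 1) * (x ^ (n + 2) * (x * Real.log x)
        - x ^ (n + 1) * (x * Real.log x)) := by
      simp only [hF]
      ring
    simp only [h]
    rw [intervalIntegral.integral_const_mul, intervalIntegral.integral_sub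
      (Continuous.intervalIntegrable (by fun_prop) _ _)
      (Continuous.intervalIntegrable (by fun_prop) _ _),
      integral_pow_mul_xlogx zero_le_one, integral_pow_mul_xlogx zero_le_one]
    push_cast
    simp only [Real.log_one]
    ring
  have hnn (n : ℕ) (x : ℝ) (hx : x ∈ Ioo (0 : ℝ) 1) : 0 ≤ F n x := by
    have h1 : 0 ≤ -(x * Real.log x) := by
      have := Real.log_nonpos hx.1.le hx.2.le
      nlinarith [hx.1]
    have h2 : 0 ≤ 1 - x := by linarith [hx.2]
    have := hx.1.le
    simp only [hF]
    positivity
  have hnorm (n : ℕ) : ∫ x in Ioo (0 : ℝ) 1, ‖F n x‖ = ∫ x in Ioo (0 : ℝ) 1, F n x :=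
    setIntegral_congr_fun measurableSet_Ioo fun x hx => Real.norm_of_nonneg (hnn n x hx)
  have key := hasSum_integral_of_summable_integral_norm (μ := volume.restrict (Ioo (0 : ℝ) 1))
    (F := F) (fun n => ((hFc n).integrableOn_Icc).mono_set Ioo_subset_Icc_self) (by
      simp only [hnorm, hFint]
      exact hasSum_harmonic_differences.summable)
  simp only [hFint] at key
  rw [hasSum_harmonic_differences.unique key, intervalIntegral.integral_of_le zero_le_one,
    integral_Ioc_eq_integral_Ioo]
  refine setIntegral_congr_fun measurableSet_Ioo fun x hx => ?_
  have hs := (Real.hasSum_pow_div_log_of_abs_lt_one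
    (abs_lt.2 ⟨by linarith [hx.1], hx.2⟩)).mul_right ((1 - x) * -(x * Real.log x))
  simp only [hF]
  rw [hs.tsum_eq]
  ring

/-! ### Integration over the simplex -/

lemma isCompact_simplex : IsCompact {p : ℝ × ℝ | 0 ≤ p.1 ∧ 0 ≤ p.2 ∧ p.1 + p.2 ≤ 1} := by
  refine (isCompact_Icc (a := ((0, 0) : ℝ × ℝ)) (b := (1, 1))).of_isClosed_subset ?_ ?_
  · exact (isClosed_le continuous_const continuous_fst).inter
      ((isClosed_le continuous_const continuous_snd).inter
        (isClosed_le (continuous_fst.add continuous_snd) continuous_const))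
  · rintro ⟨x, y⟩ ⟨hx, hy, hxy⟩
    simp only at hx hy hxy
    exact ⟨⟨hx, hy⟩, ⟨by simp only; linarith, by simp only; linarith⟩⟩

lemma Continuous.integrable_simplexMeasure {φ : ℝ × ℝ → ℝ} (hφ : Continuous φ) :
    Integrable φ simplexMeasure :=
  (hφ.continuousOn.integrableOn_compact isCompact_simplex).smul_measure (by simp)

instance : IsFiniteMeasure simplexMeasure := by
  have h : Integrable (fun _ : ℝ × ℝ => (1 : ℝ)) simplexMeasure :=
    Continuous.integrable_simplexMeasure continuous_const
  exact (integrable_const_iff.1 h).resolve_left one_ne_zero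

lemma integral_simplexMeasure {φ : ℝ × ℝ → ℝ} (hφ : Continuous φ) :
    ∫ p, φ p ∂simplexMeasure
      = 2 * ∫ x in (0 : ℝ)..1, ∫ y in (0 : ℝ)..(1 - x), φ (x, y) := by
  have hm := isCompact_simplex.measurableSet
  have hφi := hφ.continuousOn.integrableOn_compact isCompact_simplex
    (μ := (volume : Measure (ℝ × ℝ)))
  rw [simplexMeasure, integral_smul_measure, ← integral_indicator hm,
    Measure.volume_eq_prod, integral_prod _ (by
      rw [← Measure.volume_eq_prod]
      exact hφi.integrable_indicator hm), intervalIntegral.integral_of_le zero_le_one,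
    ← integral_Icc_eq_integral_Ioc, ← integral_indicator measurableSet_Icc]
  simp only [ENNReal.toReal_ofNat, smul_eq_mul]
  congr 2
  funext x
  by_cases hx : x ∈ Icc (0 : ℝ) 1
  · rw [indicator_of_mem hx, intervalIntegral.integral_of_le (by linarith [hx.2]),
      ← integral_Icc_eq_integral_Ioc, ← integral_indicator measurableSet_Icc]
    congr 1
    funext y
    simp only [indicator_apply, mem_ofPred_eq, mem_Icc]
    congr 1
    have := hx.1
    exact propext ⟨fun h => ⟨h.2.1, by linarith [h.2.2]⟩, fun h => ⟨this, h.1, by linarith [h.2]⟩⟩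
  · rw [indicator_of_notMem hx]
    rw [show (fun y => {p : ℝ × ℝ | 0 ≤ p.1 ∧ 0 ≤ p.2 ∧ p.1 + p.2 ≤ 1}.indicator φ (x, y))
      = fun _ => 0 from ?_, integral_zero]
    funext y
    refine indicator_of_notMem (fun h => hx ?_) _
    obtain ⟨h1, h2, h3⟩ := h
    simp only at h1 h2 h3
    exact ⟨h1, by linarith⟩

lemma integral_simplexMeasure_swap (φ : ℝ × ℝ → ℝ) :
    ∫ p, φ (p.2, p.1) ∂simplexMeasure = ∫ p, φ p ∂simplexMeasure := by
  have hm := isCompact_simplex.measurableSet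
  have h := (Measure.measurePreserving_swap (μ := (volume : Measure ℝ))
    (ν := (volume : Measure ℝ))).setIntegral_preimage_emb
      MeasurableEquiv.prodComm.measurableEmbedding φ
      {p : ℝ × ℝ | 0 ≤ p.1 ∧ 0 ≤ p.2 ∧ p.1 + p.2 ≤ 1}
  rw [simplexMeasure, integral_smul_measure, integral_smul_measure, Measure.volume_eq_prod, ← h]
  congr 3
  ext p
  simp only [mem_ofPred_eq, mem_preimage, Prod.fst_swap, Prod.snd_swap]
  rw [add_comm]
  tauto

lemma integral_simplexMeasure_third {φ : ℝ × ℝ → ℝ} (hφ : Continuous φ) :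
    ∫ p, φ (p.1, 1 - p.1 - p.2) ∂simplexMeasure = ∫ p, φ p ∂simplexMeasure := by
  rw [integral_simplexMeasure hφ, integral_simplexMeasure (by fun_prop)]
  congr 2
  funext x
  have h := intervalIntegral.integral_comp_sub_left (a := 0) (b := 1 - x)
    (fun y => φ (x, y)) (1 - x)
  simpa using h

lemma integral_quartic (a b c d e t : ℝ) :
    ∫ y in (0 : ℝ)..t, (a + b * y + c * y ^ 2 + d * y ^ 3 + e * y ^ 4)
      = a * t + b * t ^ 2 / 2 + c * t ^ 3 / 3 + d * t ^ 4 / 4 + e * t ^ 5 / 5 := by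
  rw [intervalIntegral.integral_eq_sub_of_hasDerivAt
    (f := fun t => a * t + b * t ^ 2 / 2 + c * t ^ 3 / 3 + d * t ^ 4 / 4 + e * t ^ 5 / 5)]
  · ring
  · intro x _
    have h := ((((((hasDerivAt_id x).const_mul a).add
      (((hasDerivAt_pow 2 x).const_mul b).div_const 2)).add
      (((hasDerivAt_pow 3 x).const_mul c).div_const 3)).add
      (((hasDerivAt_pow 4 x).const_mul d).div_const 4)).add
      (((hasDerivAt_pow 5 x).const_mul e).div_const 5))
    convert! h using 1
    norm_num
    ring
  · exact Continuous.intervalIntegrable (by fun_prop) _ _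

lemma integral_cubic_mul_xlogx (a b c d : ℝ) :
    ∫ x in (0 : ℝ)..1, (a + b * x + c * x ^ 2 + d * x ^ 3) * (x * Real.log x)
      = -(a / 4 + b / 9 + c / 16 + d / 25) := by
  have hc := Real.continuous_mul_log
  have hi (n : ℕ) (k : ℝ) :
      IntervalIntegrable (fun x : ℝ => k * (x ^ n * (x * Real.log x))) volume 0 1 :=
    Continuous.intervalIntegrable (by fun_prop) _ _
  have h (x : ℝ) : (a + b * x + c * x ^ 2 + d * x ^ 3) * (x * Real.log x)
      = a * (x ^ 0 * (x * Real.log x)) + b * (x ^ 1 * (x * Real.log x))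
        + c * (x ^ 2 * (x * Real.log x)) + d * (x ^ 3 * (x * Real.log x)) := by ring
  simp only [h]
  rw [intervalIntegral.integral_add (((hi 0 a).add (hi 1 b)).add (hi 2 c)) (hi 3 d),
    intervalIntegral.integral_add ((hi 0 a).add (hi 1 b)) (hi 2 c),
    intervalIntegral.integral_add (hi 0 a) (hi 1 b)]
  simp only [intervalIntegral.integral_const_mul, integral_pow_mul_xlogx zero_le_one]
  norm_num
  ring

lemma integral_simplexMeasure_xlogx_sq :
    ∫ p, (p.1 * Real.log p.1) ^ 2 ∂simplexMeasure = 37 / 432 := by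
  have hc := Real.continuous_mul_log
  have hi (n : ℕ) :
      IntervalIntegrable (fun x : ℝ => x ^ n * (x * Real.log x) ^ 2) volume 0 1 :=
    Continuous.intervalIntegrable (by fun_prop) _ _
  rw [integral_simplexMeasure (by fun_prop)]
  simp only [intervalIntegral.integral_const]
  have h (x : ℝ) : (1 - x - 0) • (x * Real.log x) ^ 2
      = x ^ 0 * (x * Real.log x) ^ 2 - x ^ 1 * (x * Real.log x) ^ 2 := by
    rw [smul_eq_mul]
    ring
  simp only [h]
  rw [intervalIntegral.integral_sub (hi 0) (hi 1), integral_pow_mul_xlogx_sq,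
    integral_pow_mul_xlogx_sq]
  norm_num

lemma integral_simplexMeasure_xlogx_mul :
    ∫ p, (p.1 * Real.log p.1) * (p.2 * Real.log p.2) ∂simplexMeasure
      = 187 / 864 - Real.pi ^ 2 / 72 := by
  have hc := Real.continuous_mul_log
  have hc' : Continuous fun x : ℝ => (1 - x) * Real.log (1 - x) :=
    hc.comp (continuous_const.sub continuous_id)
  rw [integral_simplexMeasure (by fun_prop)]
  have hin : EqOn
      (fun x : ℝ => ∫ y in (0 : ℝ)..(1 - x), (x * Real.log x) * (y * Real.log y))
      (fun x => (1 / 2) * ((1 - x) * ((x * Real.log x) * ((1 - x) * Real.log (1 - x))))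
        - (1 / 4 + (-1 / 2) * x + (1 / 4) * x ^ 2 + 0 * x ^ 3) * (x * Real.log x))
      (uIcc 0 1) := by
    intro x hx
    rw [uIcc_of_le zero_le_one] at hx
    have h := integral_pow_mul_xlogx (t := 1 - x) (by linarith [hx.2]) 0
    simp only [pow_zero, one_mul] at h
    simp only [intervalIntegral.integral_const_mul, h]
    norm_num
    ring
  rw [intervalIntegral.integral_congr hin, intervalIntegral.integral_sub
    (Continuous.intervalIntegrable (by fun_prop) _ _)
    (Continuous.intervalIntegrable (by fun_prop) _ _), integral_cubic_mul_xlogx,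
    intervalIntegral.integral_const_mul]
  have hrefl := intervalIntegral.integral_comp_sub_left (a := 0) (b := 1)
    (fun x => (1 - x) * ((x * Real.log x) * ((1 - x) * Real.log (1 - x)))) 1
  simp only [_root_.sub_sub_cancel, sub_self, sub_zero] at hrefl
  have hsum : (∫ x in (0 : ℝ)..1, x * (((1 - x) * Real.log (1 - x)) * (x * Real.log x)))
      + (∫ x in (0 : ℝ)..1, (1 - x) * ((x * Real.log x) * ((1 - x) * Real.log (1 - x))))
      = 37 / 108 - Real.pi ^ 2 / 36 := by
    rw [← integral_xlogx_mul_one_sub_xlogx, ← intervalIntegral.integral_add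
      (Continuous.intervalIntegrable (by fun_prop) _ _)
      (Continuous.intervalIntegrable (by fun_prop) _ _)]
    congr 1
    funext x
    ring
  linarith

/-- The entropy term `Σⱼ Dⱼ ln Dⱼ` of the spacings. -/
noncomputable def entropySum (p : ℝ × ℝ) : ℝ :=
  p.1 * Real.log p.1 + p.2 * Real.log p.2 + (1 - p.1 - p.2) * Real.log (1 - p.1 - p.2)

lemma continuous_third_mul_log :
    Continuous fun p : ℝ × ℝ => (1 - p.1 - p.2) * Real.log (1 - p.1 - p.2) :=
  Real.continuous_mul_log.comp (by fun_prop)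

lemma continuous_entropySum : Continuous entropySum := by
  have hc := Real.continuous_mul_log
  have h3 := continuous_third_mul_log
  unfold entropySum
  fun_prop

lemma integral_simplexMeasure_mul_entropySum {S : ℝ × ℝ → ℝ} (hS : Continuous S) :
    ∫ p, S p * entropySum p ∂simplexMeasure
      = ∫ p, (S (p.1, p.2) + S (p.2, p.1) + S (1 - p.1 - p.2, p.2)) * (p.1 * Real.log p.1)
          ∂simplexMeasure := by
  have hc := Real.continuous_mul_log
  have h3 := continuous_third_mul_log
  have e2 := integral_simplexMeasure_swap fun p => S p * (p.2 * Real.log p.2)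
  have e3 : ∫ p, S (1 - p.1 - p.2, p.2) * (p.1 * Real.log p.1) ∂simplexMeasure
      = ∫ p, S p * ((1 - p.1 - p.2) * Real.log (1 - p.1 - p.2)) ∂simplexMeasure := by
    rw [← integral_simplexMeasure_swap fun p => S (1 - p.1 - p.2, p.2) * (p.1 * Real.log p.1),
      ← integral_simplexMeasure_third (by fun_prop),
      ← integral_simplexMeasure_swap fun p =>
        S p * ((1 - p.1 - p.2) * Real.log (1 - p.1 - p.2))]
    congr 1
    funext p
    simp only
    rw [show 1 - (1 - p.1 - p.2) - p.1 = p.2 by ring, show 1 - p.2 - p.1 = 1 - p.1 - p.2 by ring]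
  simp only [entropySum, add_mul, mul_add]
  rw [integral_add, integral_add, integral_add, integral_add, e2, e3]
  all_goals exact Continuous.integrable_simplexMeasure (by fun_prop)

lemma integral_simplexMeasure_entropySum_sq :
    ∫ p, entropySum p ^ 2 ∂simplexMeasure = 14 / 9 - Real.pi ^ 2 / 12 := by
  have hc := Real.continuous_mul_log
  have h3 := continuous_third_mul_log
  have hH := continuous_entropySum
  have h (p : ℝ × ℝ) : entropySum p ^ 2 = entropySum p * entropySum p := sq _
  simp only [h]
  rw [integral_simplexMeasure_mul_entropySum hH]
  have hx (p : ℝ × ℝ) : (entropySum (p.1, p.2) + entropySum (p.2, p.1)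
      + entropySum (1 - p.1 - p.2, p.2)) * (p.1 * Real.log p.1)
      = 3 * (p.1 * Real.log p.1) ^ 2 + (3 * ((p.1 * Real.log p.1) * (p.2 * Real.log p.2))
        + 3 * ((p.1 * Real.log p.1) * ((1 - p.1 - p.2) * Real.log (1 - p.1 - p.2)))) := by
    simp only [entropySum]
    rw [show 1 - (1 - p.1 - p.2) - p.2 = p.1 by ring, show 1 - p.2 - p.1 = 1 - p.1 - p.2 by ring]
    ring
  simp only [hx]
  have e := integral_simplexMeasure_third
    (φ := fun p => (p.1 * Real.log p.1) * (p.2 * Real.log p.2)) (by fun_prop)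
  rw [integral_add, integral_add, integral_const_mul, integral_const_mul, integral_const_mul, e,
    integral_simplexMeasure_xlogx_sq, integral_simplexMeasure_xlogx_mul]
  · ring
  all_goals exact Continuous.integrable_simplexMeasure (by fun_prop)

lemma continuous_cmpToll : Continuous cmpToll := by
  have hH := continuous_entropySum
  have h : cmpToll = fun p => 1 + (p.1 + p.2) * (p.2 + 2 * (1 - p.1 - p.2))
      + (19 / 10) * entropySum p := rfl
  rw [h]
  fun_prop

lemma continuous_swapToll : Continuous swapToll := by
  have hH := continuous_entropySum
  have h : swapToll = fun p => p.1 + (p.1 + p.2) * (1 - p.1 - p.2)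
      + (3 / 5) * entropySum p := rfl
  rw [h]
  fun_prop

lemma integral_poly_part :
    ∫ p, (1 + (p.1 + p.2) * (p.2 + 2 * (1 - p.1 - p.2)))
        * (p.1 + (p.1 + p.2) * (1 - p.1 - p.2)) ∂simplexMeasure = 23 / 30 := by
  rw [integral_simplexMeasure (by fun_prop)]
  have h (x y : ℝ) : (1 + (x + y) * (y + 2 * (1 - x - y))) * (x + (x + y) * (1 - x - y))
      = (2 * x + 3 * x ^ 2 - 6 * x ^ 3 + 2 * x ^ 4) + (1 + 4 * x - 14 * x ^ 2 + 7 * x ^ 3) * y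
        + (1 - 11 * x + 9 * x ^ 2) * y ^ 2 + (-3 + 5 * x) * y ^ 3 + 1 * y ^ 4 := by ring
  simp only [h, integral_quartic]
  have h' (x : ℝ) : (2 * x + 3 * x ^ 2 - 6 * x ^ 3 + 2 * x ^ 4) * (1 - x)
      + (1 + 4 * x - 14 * x ^ 2 + 7 * x ^ 3) * (1 - x) ^ 2 / 2
      + (1 - 11 * x + 9 * x ^ 2) * (1 - x) ^ 3 / 3 + (-3 + 5 * x) * (1 - x) ^ 4 / 4
      + 1 * (1 - x) ^ 5 / 5
      = (17 / 60 + 19 / 12 * x + (-2) * x ^ 2 + (-4 / 3) * x ^ 3 + 23 / 12 * x ^ 4)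
        + (-9 / 20) * x ^ 5 := by ring
  simp only [h']
  rw [intervalIntegral.integral_add (Continuous.intervalIntegrable (by fun_prop) _ _)
    (Continuous.intervalIntegrable (by fun_prop) _ _), integral_quartic,
    intervalIntegral.integral_const_mul, integral_pow]
  norm_num

lemma integral_cross_part :
    ∫ p, ((3 / 5) * (1 + (p.1 + p.2) * (p.2 + 2 * (1 - p.1 - p.2)))
        + (19 / 10) * (p.1 + (p.1 + p.2) * (1 - p.1 - p.2))) * entropySum p ∂simplexMeasure
      = -241 / 150 := by
  have hc := Real.continuous_mul_log
  rw [integral_simplexMeasure_mul_entropySum (S := fun p =>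
    (3 / 5) * (1 + (p.1 + p.2) * (p.2 + 2 * (1 - p.1 - p.2)))
        + (19 / 10) * (p.1 + (p.1 + p.2) * (1 - p.1 - p.2))) (by fun_prop),
    integral_simplexMeasure (by fun_prop)]
  have h (x y : ℝ) : ((3 / 5) * (1 + (x + y) * (y + 2 * (1 - x - y)))
        + (19 / 10) * (x + (x + y) * (1 - x - y))
      + ((3 / 5) * (1 + (y + x) * (x + 2 * (1 - y - x)))
        + (19 / 10) * (y + (y + x) * (1 - y - x)))
      + ((3 / 5) * (1 + (1 - x - y + y) * (y + 2 * (1 - (1 - x - y) - y)))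
        + (19 / 10) * (1 - x - y + (1 - x - y + y) * (1 - (1 - x - y) - y))))
        * (x * Real.log x)
      = ((37 / 10 + 93 / 10 * x - 87 / 10 * x ^ 2) + (34 / 5 - 59 / 5 * x) * y
        + (-28 / 5) * y ^ 2 + 0 * y ^ 3 + 0 * y ^ 4) * (x * Real.log x) := by ring
  simp only [h, intervalIntegral.integral_mul_const, integral_quartic]
  have h' (x : ℝ) : (37 / 10 + 93 / 10 * x - 87 / 10 * x ^ 2) * (1 - x)
      + (34 / 5 - 59 / 5 * x) * (1 - x) ^ 2 / 2 + (-28 / 5) * (1 - x) ^ 3 / 3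
      + 0 * (1 - x) ^ 4 / 4 + 0 * (1 - x) ^ 5 / 5
      = 157 / 30 + (-3 / 2) * x + (-42 / 5) * x ^ 2 + 14 / 3 * x ^ 3 := by ring
  simp only [h', integral_cubic_mul_xlogx]
  norm_num

lemma integral_cmpToll_mul_swapToll :
    ∫ p, cmpToll p * swapToll p ∂simplexMeasure = 14 / 15 - (19 / 200) * Real.pi ^ 2 := by
  have hH := continuous_entropySum
  have h (p : ℝ × ℝ) : cmpToll p * swapToll p
      = (1 + (p.1 + p.2) * (p.2 + 2 * (1 - p.1 - p.2))) * (p.1 + (p.1 + p.2) * (1 - p.1 - p.2))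
        + ((3 / 5) * (1 + (p.1 + p.2) * (p.2 + 2 * (1 - p.1 - p.2)))
          + (19 / 10) * (p.1 + (p.1 + p.2) * (1 - p.1 - p.2))) * entropySum p
        + (57 / 50) * entropySum p ^ 2 := by
    simp only [cmpToll, swapToll, entropySum]
    ring
  simp only [h]
  rw [integral_add, integral_add, integral_poly_part, integral_cross_part, integral_const_mul,
    integral_simplexMeasure_entropySum_sq]
  · ring
  all_goals exact Continuous.integrable_simplexMeasure (by fun_prop)

lemma integral_simplexMeasure_fst_sq : ∫ p, p.1 * p.1 ∂simplexMeasure = 1 / 6 := by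
  rw [integral_simplexMeasure (by fun_prop)]
  simp only [intervalIntegral.integral_const, smul_eq_mul]
  have h (x : ℝ) : (1 - x - 0) * (x * x)
      = 0 + 0 * x + 1 * x ^ 2 + (-1) * x ^ 3 + 0 * x ^ 4 := by ring
  simp only [h, integral_quartic]
  norm_num

lemma integral_simplexMeasure_snd_sq : ∫ p, p.2 * p.2 ∂simplexMeasure = 1 / 6 := by
  rw [← integral_simplexMeasure_fst_sq, ← integral_simplexMeasure_swap]

lemma integral_simplexMeasure_third_sq :
    ∫ p, (1 - p.1 - p.2) * (1 - p.1 - p.2) ∂simplexMeasure = 1 / 6 := by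
  rw [← integral_simplexMeasure_snd_sq,
    ← integral_simplexMeasure_third (φ := fun p => p.2 * p.2) (by fun_prop)]

/-! ### The fixed-point equation -/

/-- `F` is integrable with integral `c`. -/
def HasIntegralValue {α : Type*} [MeasurableSpace α] (F : α → ℝ) (c : ℝ) (μ : Measure α) : Prop :=
  Integrable F μ ∧ ∫ x, F x ∂μ = c

lemma HasIntegralValue.add {α : Type*} [MeasurableSpace α] {F G : α → ℝ} {c d : ℝ}
    {μ : Measure α} (hF : HasIntegralValue F c μ) (hG : HasIntegralValue G d μ) :
    HasIntegralValue (fun x => F x + G x) (c + d) μ :=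
  ⟨hF.1.add hG.1, by rw [integral_add hF.1 hG.1, hF.2, hG.2]⟩

lemma HasIntegralValue.mul_prod {α β : Type*} [MeasurableSpace α] [MeasurableSpace β]
    {F : α → ℝ} {G : β → ℝ} {c d : ℝ} {μ : Measure α} {ν : Measure β} [SFinite μ] [SFinite ν]
    (hF : HasIntegralValue F c μ) (hG : HasIntegralValue G d ν) :
    HasIntegralValue (fun z : α × β => F z.1 * G z.2) (c * d) (μ.prod ν) :=
  ⟨hF.1.mul_prod hG.1, by rw [integral_prod_mul, hF.2, hG.2]⟩

lemma Continuous.hasIntegralValue_simplexMeasure {φ : ℝ × ℝ → ℝ} (hφ : Continuous φ) :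
    HasIntegralValue φ (∫ p, φ p ∂simplexMeasure) simplexMeasure :=
  ⟨hφ.integrable_simplexMeasure, rfl⟩

/-- For the (unique) centered square-integrable bivariate fixed point `(Λ₁,Λ₂)` of
`(Λ₁,Λ₂) =_d Σ_r D_r (Λ₁⁽ʳ⁾,Λ₂⁽ʳ⁾) + (f(D),g(D))`, the asymptotic covariance
constant of comparisons and swaps is `σ_{C,S} = E[Λ₁Λ₂] = 28/15 − (19/100)π²`;
in particular `2·E[f(D)·g(D)] = 28/15 − (19/100)π²`. -/
theorem covariance_constant (ν : Measure (ℝ × ℝ)) [IsProbabilityMeasure ν]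
    (hcent1 : (∫ p, p.1 ∂ν) = 0) (hcent2 : (∫ p, p.2 ∂ν) = 0)
    (hsq1 : Integrable (fun p : ℝ × ℝ => p.1 ^ 2) ν)
    (hsq2 : Integrable (fun p : ℝ × ℝ => p.2 ^ 2) ν)
    (hfix : Measure.map
        (fun ω : (ℝ × ℝ) × (ℝ × ℝ) × (ℝ × ℝ) × (ℝ × ℝ) =>
          (cmpToll ω.1 + ω.1.1 * ω.2.1.1 + ω.1.2 * ω.2.2.1.1
              + (1 - ω.1.1 - ω.1.2) * ω.2.2.2.1,
           swapToll ω.1 + ω.1.1 * ω.2.1.2 + ω.1.2 * ω.2.2.1.2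
              + (1 - ω.1.1 - ω.1.2) * ω.2.2.2.2))
        (simplexMeasure.prod (ν.prod (ν.prod ν))) = ν) :
    (∫ p, p.1 * p.2 ∂ν) = 28 / 15 - (19 / 100) * Real.pi ^ 2 ∧
    2 * (∫ p, cmpToll p * swapToll p ∂simplexMeasure)
      = 28 / 15 - (19 / 100) * Real.pi ^ 2 := by
  have hcov : HasIntegralValue (fun p : ℝ × ℝ => p.1 * p.2) (∫ p, p.1 * p.2 ∂ν) ν :=
    ⟨((memLp_two_iff_integrable_sq (by fun_prop)).2 hsq1).integrable_mul
      ((memLp_two_iff_integrable_sq (by fun_prop)).2 hsq2), rfl⟩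
  have hone : HasIntegralValue (fun _ : ℝ × ℝ => (1 : ℝ)) 1 ν :=
    ⟨integrable_const _, by simp⟩
  have hfst : HasIntegralValue (fun p : ℝ × ℝ => p.1) 0 ν :=
    ⟨((memLp_two_iff_integrable_sq (by fun_prop)).2 hsq1).integrable one_le_two, hcent1⟩
  have hsnd : HasIntegralValue (fun p : ℝ × ℝ => p.2) 0 ν :=
    ⟨((memLp_two_iff_integrable_sq (by fun_prop)).2 hsq2).integrable one_le_two, hcent2⟩
  have hf := continuous_cmpToll
  have hg := continuous_swapToll
  have term {φ u v w : ℝ × ℝ → ℝ} {a b c : ℝ} (hφ : Continuous φ) (hu : HasIntegralValue u a ν)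
      (hv : HasIntegralValue v b ν) (hw : HasIntegralValue w c ν) :=
    hφ.hasIntegralValue_simplexMeasure.mul_prod (hu.mul_prod (hv.mul_prod hw))
  have c3 : Continuous fun p : ℝ × ℝ => 1 - p.1 - p.2 := by fun_prop
  have total := (((((((((((((((
    term (hf.mul hg) hone hone hone).add
    (term (hf.mul continuous_fst) hsnd hone hone)).add
    (term (hf.mul continuous_snd) hone hsnd hone)).add
    (term (hf.mul c3) hone hone hsnd)).add
    (term (continuous_fst.mul hg) hfst hone hone)).add
    (term (continuous_fst.mul continuous_fst) hcov hone hone)).add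
    (term (continuous_fst.mul continuous_snd) hfst hsnd hone)).add
    (term (continuous_fst.mul c3) hfst hone hsnd)).add
    (term (continuous_snd.mul hg) hone hfst hone)).add
    (term (continuous_snd.mul continuous_fst) hsnd hfst hone)).add
    (term (continuous_snd.mul continuous_snd) hone hcov hone)).add
    (term (continuous_snd.mul c3) hone hfst hsnd)).add
    (term (c3.mul hg) hone hone hfst)).add
    (term (c3.mul continuous_fst) hsnd hone hfst)).add
    (term (c3.mul continuous_snd) hone hsnd hfst)).add
    (term (c3.mul c3) hone hone hcov)
  have hT : Measurable fun ω : (ℝ × ℝ) × (ℝ × ℝ) × (ℝ × ℝ) × (ℝ × ℝ) =>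
      (cmpToll ω.1 + ω.1.1 * ω.2.1.1 + ω.1.2 * ω.2.2.1.1
          + (1 - ω.1.1 - ω.1.2) * ω.2.2.2.1,
       swapToll ω.1 + ω.1.1 * ω.2.1.2 + ω.1.2 * ω.2.2.1.2
          + (1 - ω.1.1 - ω.1.2) * ω.2.2.2.2) :=
    Continuous.measurable (by fun_prop)
  have hmap := integral_map (μ := simplexMeasure.prod (ν.prod (ν.prod ν))) hT.aemeasurable
    (f := fun p : ℝ × ℝ => p.1 * p.2) (Continuous.aestronglyMeasurable (by fun_prop))
  rw [hfix] at hmap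
  have hrec : ∫ p, p.1 * p.2 ∂ν
      = ∫ p, cmpToll p * swapToll p ∂simplexMeasure + (1 / 2) * ∫ p, p.1 * p.2 ∂ν := by
    refine hmap.trans (Eq.trans ?_ (total.2.trans ?_))
    · congr 1
      funext ω
      simp only [Pi.mul_apply]
      ring
    · simp only [Pi.mul_apply]
      rw [integral_simplexMeasure_fst_sq, integral_simplexMeasure_snd_sq,
        integral_simplexMeasure_third_sq]
      ring
  rw [integral_cmpToll_mul_swapToll] at hrec ⊢
  constructor <;> linarith
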